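/- Let d ≥ 3 be an integer and 0 < ε < 1, and define the bilinear form B(v,w) = ∫_{ℝ^d} conj(v(x)) · (|x|^ε/(1+|x|^ε)) · (x/|x|)·∇w(x) dx. Then for all Schwartz functions v, w on ℝ^d with values in ℂ, |B(v,w)| ≤ 3 (∫_{ℝ^d} 2π|ξ| |Fv(ξ)|² dξ)^{1/2} (∫_{ℝ^d} 2π|ξ| |Fw(ξ)|² dξ)^{1/2}, where F denotes the Fourier transform Fv(ξ) = ∫_{ℝ^d} v(x) e^{−2πi x·ξ} dx. -/

import Mathlib

open MeasureTheory Metric Real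
open scoped FourierTransform

section FormInterpolation

open scoped InnerProductSpace

variable {H : Type*} [NormedAddCommGroup H] [InnerProductSpace ℂ H]

/-- The Cauchy–Schwarz inequality for the form of a positive operator. -/
theorem norm_inner_sq_le_of_isPositive {Q : H →L[ℂ] H} (hQ : Q.IsPositive) (x y : H) :
    ‖⟪x, Q y⟫_ℂ‖ ^ 2 ≤ (⟪x, Q x⟫_ℂ).re * (⟪y, Q y⟫_ℂ).re := by
  let c : PreInnerProductSpace.Core ℂ H :=
    { inner := fun x y => ⟪x, Q y⟫_ℂ
      conj_inner_symm := fun x y => by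
        rw [inner_conj_symm, hQ.inner_left_eq_inner_right]
      re_inner_nonneg := fun x => hQ.re_inner_nonneg_right x
      add_left := fun x y z => inner_add_left _ _ _
      smul_left := fun x y r => inner_smul_left _ _ _ }
  have h := @InnerProductSpace.Core.inner_mul_inner_self_le ℂ H _ _ _ c x y
  have h2 : ‖⟪x, Q y⟫_ℂ‖ = ‖⟪y, Q x⟫_ℂ‖ := by
    rw [← hQ.inner_left_eq_inner_right, norm_inner_symm]
  rw [sq]
  nth_rewrite 2 [h2]
  exact h

/-- A log-convex sequence of nonnegative reals of exponential growth rate at most `c` has first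
ratio at most `c`. -/
theorem le_mul_of_sq_le_mul {a : ℕ → ℝ} {K c : ℝ} (hc : 0 ≤ c) (ha : ∀ n, 0 ≤ a n)
    (hlog : ∀ n, a (n + 1) ^ 2 ≤ a n * a (n + 2)) (hK : ∀ n, a n ≤ K * c ^ n) :
    a 1 ≤ c * a 0 := by
  by_contra! hlt
  have ha1 : 0 < a 1 := lt_of_le_of_lt (mul_nonneg hc (ha 0)) hlt
  have ha0 : 0 < a 0 := by
    rcases (ha 0).lt_or_eq with h | h
    · exact h
    · have := hlog 0
      rw [← h, zero_mul] at this
      simp only [zero_add] at this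
      nlinarith
  have hc0 : 0 < c := by
    rcases hc.lt_or_eq with h | h
    · exact h
    · have := hK 1
      rw [← h] at this
      simp at this
      linarith
  set r := a 1 / a 0 with hr
  have hr0 : 0 < r := by positivity
  have hrc : c < r := by rw [hr, lt_div_iff₀ ha0]; exact hlt
  have step : ∀ n, 0 < a n ∧ r * a n ≤ a (n + 1) := by
    intro n
    induction n with
    | zero => exact ⟨ha0, by rw [hr]; field_simp; simp⟩
    | succ n ih =>
      obtain ⟨h1, h2⟩ := ih
      have h3 : 0 < a (n + 1) := lt_of_lt_of_le (by positivity) h2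
      refine ⟨h3, ?_⟩
      have h4 := hlog n
      have h5 : a n * (r * a (n + 1)) ≤ a n * a (n + 1 + 1) := by
        calc a n * (r * a (n + 1)) = (r * a n) * a (n + 1) := by ring
          _ ≤ a (n + 1) * a (n + 1) := by gcongr
          _ = a (n + 1) ^ 2 := by ring
          _ ≤ _ := h4
      exact le_of_mul_le_mul_left h5 h1
  have hpow : ∀ n, a 0 * r ^ n ≤ a n := by
    intro n
    induction n with
    | zero => simp
    | succ n ih =>
      calc a 0 * r ^ (n + 1) = r * (a 0 * r ^ n) := by ring
        _ ≤ r * a n := by gcongr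
        _ ≤ _ := (step n).2
  have hrc1 : 1 < r / c := by rwa [one_lt_div hc0]
  obtain ⟨n, hn⟩ := pow_unbounded_of_one_lt (K / a 0) hrc1
  rw [div_pow, div_lt_div_iff₀ ha0 (by positivity)] at hn
  have := (hpow n).trans (hK n)
  linarith

/-- Lax's theorem: an operator that is symmetric for the form of a positive operator `Q` is
bounded for that form by its operator norm. -/
theorem re_inner_apply_le_of_symmetrizable {Q D : H →L[ℂ] H} (hQ : Q.IsPositive)
    (hD : ∀ x y, ⟪x, Q (D y)⟫_ℂ = ⟪D x, Q y⟫_ℂ) {c : ℝ} (hc : 0 ≤ c) (hDc : ∀ x, ‖D x‖ ≤ c * ‖x‖)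
    (x : H) : (⟪x, Q (D x)⟫_ℂ).re ≤ c * (⟪x, Q x⟫_ℂ).re := by
  set a : ℕ → ℝ := fun n => (⟪(D ^ n) x, Q ((D ^ n) x)⟫_ℂ).re with ha
  have ha0 : ∀ n, 0 ≤ a n := fun n => hQ.re_inner_nonneg_right _
  have hsucc : ∀ n, (D ^ (n + 1)) x = D ((D ^ n) x) := fun n => by
    rw [pow_succ', mul_apply_eq_comp]
  have hlog : ∀ n, a (n + 1) ^ 2 ≤ a n * a (n + 2) := by
    intro n
    have h1 : a (n + 1) = (⟪(D ^ n) x, Q ((D ^ (n + 2)) x)⟫_ℂ).re := by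
      simp only [ha]
      rw [show n + 2 = (n + 1) + 1 from rfl, hsucc (n + 1), hD, ← hsucc n]
    have h2 := norm_inner_sq_le_of_isPositive hQ ((D ^ n) x) ((D ^ (n + 2)) x)
    refine le_trans ?_ h2
    rw [h1, ← sq_abs]
    gcongr
    exact Complex.abs_re_le_norm _
  have hnorm : ∀ n, ‖(D ^ n) x‖ ≤ c ^ n * ‖x‖ := by
    intro n
    induction n with
    | zero => simp
    | succ n ih =>
      rw [hsucc]
      calc _ ≤ c * ‖(D ^ n) x‖ := hDc _
        _ ≤ c * (c ^ n * ‖x‖) := by gcongr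
        _ = _ := by ring
  have hK : ∀ n, a n ≤ (‖Q‖ * ‖x‖ ^ 2) * (c ^ 2) ^ n := by
    intro n
    calc a n ≤ ‖⟪(D ^ n) x, Q ((D ^ n) x)⟫_ℂ‖ := Complex.re_le_norm _
      _ ≤ ‖(D ^ n) x‖ * ‖Q ((D ^ n) x)‖ := norm_inner_le_norm _ _
      _ ≤ ‖(D ^ n) x‖ * (‖Q‖ * ‖(D ^ n) x‖) := by gcongr; exact Q.le_opNorm _
      _ = ‖Q‖ * ‖(D ^ n) x‖ ^ 2 := by ring
      _ ≤ ‖Q‖ * (c ^ n * ‖x‖) ^ 2 := by gcongr; exact hnorm n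
      _ = _ := by ring
  have h1 := le_mul_of_sq_le_mul (sq_nonneg c) ha0 hlog hK
  have h2 := norm_inner_sq_le_of_isPositive hQ x (D x)
  have e0 : a 0 = (⟪x, Q x⟫_ℂ).re := by simp [ha]
  have e1 : a 1 = (⟪D x, Q (D x)⟫_ℂ).re := by simp [ha]
  rw [← e0, ← e1] at h2
  rw [← e0]
  refine (Complex.re_le_norm _).trans (abs_le_of_sq_le_sq' ?_ (mul_nonneg hc (ha0 0))).2
  calc _ ≤ a 0 * a 1 := h2
    _ ≤ a 0 * (c ^ 2 * a 0) := by gcongr; exact ha0 0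
    _ = _ := by ring

/-- Interpolation at the midpoint between the bounds `‖v‖ ‖Λ w‖` and `‖Λ v‖ ‖w‖` for a
sesquilinear form on a dense subspace, where `Λ` is symmetric with positive bounded inverse. -/
theorem norm_inner_sq_le_of_endpoints [CompleteSpace H] {S : Type*} [AddCommGroup S] [Module ℂ S]
    (ι T : S →ₗ[ℂ] H) (Λ M : S →ₗ[ℂ] S) (hι : DenseRange ι) (hΛM : ∀ s, Λ (M s) = s)
    (hMΛ : ∀ s, M (Λ s) = s) {c : ℝ} (hM : ∀ s, ‖ι (M s)‖ ≤ c * ‖ι s‖)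
    (hsymm : ∀ s t, ⟪ι (M s), ι t⟫_ℂ = ⟪ι s, ι (M t)⟫_ℂ)
    (hpos : ∀ s, 0 ≤ (⟪ι s, ι (M s)⟫_ℂ).re) {α β : ℝ} (hα : 0 ≤ α) (hβ : 0 ≤ β)
    (h1 : ∀ w, ‖T w‖ ≤ α * ‖ι (Λ w)‖)
    (h2 : ∀ v w, ‖⟪ι v, T w⟫_ℂ‖ ≤ β * (‖ι (Λ v)‖ * ‖ι w‖)) (v w : S) :
    ‖⟪ι v, T w⟫_ℂ‖ ^ 2 ≤ α * β * (⟪ι v, ι (Λ v)⟫_ℂ).re * (⟪ι w, ι (Λ w)⟫_ℂ).re := by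
  set Q : H →L[ℂ] H := (ι ∘ₗ M).extendOfNorm ι with hQdef
  have hQι : ∀ s, Q (ι s) = ι (M s) := fun s => LinearMap.extendOfNorm_eq hι ⟨c, hM⟩ s
  have hQsymm : ∀ x y, ⟪Q x, y⟫_ℂ = ⟪x, Q y⟫_ℂ := by
    intro x y
    refine hι.induction_on₂ (p := fun x y => ⟪Q x, y⟫_ℂ = ⟪x, Q y⟫_ℂ)
      (isClosed_eq (by fun_prop) (by fun_prop)) (fun s t => ?_) x y
    rw [hQι, hQι, hsymm]
  have hQ : Q.IsPositive := by
    rw [ContinuousLinearMap.isPositive_def]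
    refine ⟨hQsymm, fun x => ?_⟩
    refine hι.induction_on (p := fun x => 0 ≤ Q.reApplyInnerSelf x) x
      (isClosed_le continuous_const Q.reApplyInnerSelf_continuous) (fun s => ?_)
    rw [ContinuousLinearMap.reApplyInnerSelf_apply, hQsymm, hQι]
    exact hpos s
  have hAb : ∀ s, ‖(T ∘ₗ M) s‖ ≤ α * ‖ι s‖ := fun s => by simpa [hΛM] using h1 (M s)
  have hCb : ∀ s, ‖((Q : H →ₗ[ℂ] H) ∘ₗ T) s‖ ≤ β * ‖ι s‖ := by
    intro s
    have key : ∀ x : H, ‖⟪x, Q (T s)⟫_ℂ‖ ≤ β * ‖ι s‖ * ‖x‖ := by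
      intro x
      refine hι.induction_on (p := fun x => ‖⟪x, Q (T s)⟫_ℂ‖ ≤ β * ‖ι s‖ * ‖x‖) x
        (isClosed_le (by fun_prop) (by fun_prop)) (fun t => ?_)
      rw [← hQsymm, hQι]
      refine (h2 (M t) s).trans (le_of_eq ?_)
      rw [hΛM]; ring
    have h3 := key (Q (T s))
    rw [inner_self_eq_norm_sq_to_K] at h3
    simp only [Complex.coe_algebraMap, norm_pow, Complex.norm_real, norm_norm] at h3
    change ‖Q (T s)‖ ≤ _
    rcases (norm_nonneg (Q (T s))).lt_or_eq with h | h
    · exact le_of_mul_le_mul_right (by rw [← sq]; exact h3) h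
    · rw [← h]; positivity
  set A : H →L[ℂ] H := (T ∘ₗ M).extendOfNorm ι
  set C : H →L[ℂ] H := ((Q : H →ₗ[ℂ] H) ∘ₗ T).extendOfNorm ι
  have hAι : ∀ s, A (ι s) = T (M s) := fun s => LinearMap.extendOfNorm_eq hι ⟨α, hAb⟩ s
  have hCι : ∀ s, C (ι s) = Q (T s) := fun s => LinearMap.extendOfNorm_eq hι ⟨β, hCb⟩ s
  have hA : ‖A‖ ≤ α := LinearMap.opNorm_extendOfNorm_le hι hα hAb
  have hC : ‖C‖ ≤ β := LinearMap.opNorm_extendOfNorm_le hι hβ hCb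
  have hQA : ∀ x, Q (A x) = C (Q x) := by
    intro x
    refine hι.induction_on (p := fun x => Q (A x) = C (Q x)) x
      (isClosed_eq (by fun_prop) (by fun_prop)) (fun s => ?_)
    rw [hAι, hQι, hCι]
  set C' := ContinuousLinearMap.adjoint C
  have hD : ∀ x y, ⟪x, Q ((A ∘L C') y)⟫_ℂ = ⟪C' x, Q (C' y)⟫_ℂ := by
    intro x y
    rw [ContinuousLinearMap.comp_apply, hQA, ContinuousLinearMap.adjoint_inner_left]
  have hlax : ∀ x, (⟪C' x, Q (C' x)⟫_ℂ).re ≤ α * β * (⟪x, Q x⟫_ℂ).re := by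
    intro x
    rw [← hD]
    refine re_inner_apply_le_of_symmetrizable hQ (fun x y => ?_) (mul_nonneg hα hβ) (fun y => ?_) x
    · rw [hD, ← hQsymm, ← hQsymm, ← inner_conj_symm, ← inner_conj_symm (Q _), hD]
    · calc ‖A (C' y)‖ ≤ ‖A‖ * (‖C'‖ * ‖y‖) := A.le_opNorm_of_le (C'.le_opNorm y)
        _ = ‖A‖ * (‖C‖ * ‖y‖) := by rw [LinearIsometryEquiv.norm_map]
        _ ≤ α * (β * ‖y‖) := by gcongr
        _ = _ := by ring
  have hfin : ⟪ι v, T w⟫_ℂ = ⟪C' (ι (Λ v)), Q (ι (Λ w))⟫_ℂ := by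
    rw [ContinuousLinearMap.adjoint_inner_left, hQι, hMΛ, hCι, ← hQsymm, hQι, hMΛ]
  have e : ∀ s, (⟪ι (Λ s), Q (ι (Λ s))⟫_ℂ).re = (⟪ι s, ι (Λ s)⟫_ℂ).re := by
    intro s
    rw [← hQsymm, hQι, hMΛ]
  rw [hfin]
  refine (norm_inner_sq_le_of_isPositive hQ _ _).trans ?_
  rw [e w]
  have := hlax (ι (Λ v))
  rw [e v] at this
  refine mul_le_mul_of_nonneg_right this ?_
  rw [← e w]
  exact hQ.re_inner_nonneg_right _

end FormInterpolation

section Radial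

open scoped InnerProductSpace SchwartzMap LineDeriv Topology
open Filter

variable {d : ℕ}

local notation "𝔼" => EuclideanSpace ℝ (Fin d)

/-- The Cauchy–Schwarz inequality for square-integrable nonnegative functions. -/
theorem integral_mul_le_sqrt_mul_sqrt {α : Type*} [MeasurableSpace α] {μ : Measure α}
    {f g : α → ℝ} (hf0 : ∀ x, 0 ≤ f x) (hg0 : ∀ x, 0 ≤ g x) (hf : MemLp f 2 μ)
    (hg : MemLp g 2 μ) :
    ∫ x, f x * g x ∂μ ≤ √(∫ x, f x ^ 2 ∂μ) * √(∫ x, g x ^ 2 ∂μ) := by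
  have h := integral_mul_le_Lp_mul_Lq_of_nonneg (μ := μ) (f := f) (g := g)
    Real.HolderConjugate.two_two (.of_forall hf0) (.of_forall hg0) (by simpa using hf)
    (by simpa using hg)
  simpa [Real.sqrt_eq_rpow] using h

/-- Integration by parts against a vector field `x ↦ φ x • x` of at most bounded growth. -/
theorem integral_smul_fderiv_self_eq {F : Type*} [NormedAddCommGroup F] [NormedSpace ℝ F]
    {φ : 𝔼 → ℝ} {u : 𝔼 → F} {C₁ C₂ C₃ : ℝ} (hφ : Differentiable ℝ φ)
    (hφ1 : ∀ x, |φ x| ≤ C₁) (hφ2 : ∀ x, |φ x| * ‖x‖ ≤ C₂)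
    (hφ3 : ∀ x, ‖fderiv ℝ φ x‖ * ‖x‖ ≤ C₃) (hu : Differentiable ℝ u)
    (hui : Integrable u) (hu' : Integrable (fderiv ℝ u)) :
    ∫ x, φ x • fderiv ℝ u x x = -∫ x, (d * φ x + fderiv ℝ φ x x) • u x := by
  let e : Fin d → 𝔼 := fun i => EuclideanSpace.basisFun (Fin d) ℝ i
  have he : ∀ i, ‖e i‖ = 1 := fun i => by simp [e]
  have hx : ∀ x : 𝔼, x = ∑ i, x i • e i := fun x => by
    simpa [e] using ((EuclideanSpace.basisFun (Fin d) ℝ).sum_repr x).symm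
  have hxi : ∀ (x : 𝔼) i, |x i| ≤ ‖x‖ := fun x i => by
    simpa using PiLp.norm_apply_le x i
  have hcoord : ∀ i, Differentiable ℝ (fun x : 𝔼 => x i) := fun i => by fun_prop
  have hcoord' : ∀ i (x : 𝔼), fderiv ℝ (fun x : 𝔼 => x i) x (e i) = 1 := fun i x => by
    have : HasFDerivAt (fun x : 𝔼 => x i) (EuclideanSpace.proj i : 𝔼 →L[ℝ] ℝ) x :=
      (EuclideanSpace.proj i : 𝔼 →L[ℝ] ℝ).hasFDerivAt
    rw [this.fderiv]
    simp [e]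
  have hfd : ∀ i x, fderiv ℝ (fun x : 𝔼 => φ x * x i) x (e i)
      = φ x + x i * fderiv ℝ φ x (e i) := by
    intro i x
    rw [fderiv_fun_mul (hφ x) (hcoord i x)]
    simp [hcoord' i x]
  have hmφ' : ∀ i, AEStronglyMeasurable (fun x => fderiv ℝ φ x (e i)) volume := fun i =>
    (measurable_fderiv_apply_const ℝ φ (e i)).aestronglyMeasurable
  have hcx : ∀ i, Continuous (fun x : 𝔼 => x i) := fun i => (hcoord i).continuous
  have hi1 : ∀ i, Integrable (fun x : 𝔼 => (φ x * x i) • fderiv ℝ u x (e i)) := by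
    intro i
    refine (hu'.apply_continuousLinearMap (e i)).bdd_smul C₂
      (hφ.continuous.mul (hcx i)).aestronglyMeasurable (.of_forall fun x => ?_)
    rw [norm_mul, Real.norm_eq_abs, Real.norm_eq_abs]
    exact (mul_le_mul_of_nonneg_left (hxi x i) (abs_nonneg _)).trans (hφ2 x)
  have hi2 : ∀ i, Integrable (fun x : 𝔼 => (φ x + x i * fderiv ℝ φ x (e i)) • u x) := by
    intro i
    refine hui.bdd_smul (C₁ + C₃)
      (hφ.continuous.aestronglyMeasurable.add ((hcx i).aestronglyMeasurable.mul (hmφ' i)))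
      (.of_forall fun x => ?_)
    refine (norm_add_le _ _).trans (add_le_add (hφ1 x) (le_trans ?_ (hφ3 x)))
    rw [norm_mul, mul_comm, Real.norm_eq_abs (x i)]
    have := (fderiv ℝ φ x).le_opNorm (e i)
    rw [he, mul_one] at this
    gcongr
    exact hxi x i
  have hi3 : ∀ i, Integrable (fun x : 𝔼 => (φ x * x i) • u x) := by
    intro i
    refine hui.bdd_smul C₂ (hφ.continuous.mul (hcx i)).aestronglyMeasurable
      (.of_forall fun x => ?_)
    rw [norm_mul, Real.norm_eq_abs, Real.norm_eq_abs]
    exact (mul_le_mul_of_nonneg_left (hxi x i) (abs_nonneg _)).trans (hφ2 x)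
  have hibp : ∀ i, ∫ x, (φ x * x i) • fderiv ℝ u x (e i)
      = -∫ x, (φ x + x i * fderiv ℝ φ x (e i)) • u x := by
    intro i
    simp_rw [← hfd]
    refine integral_smul_fderiv_eq_neg_fderiv_smul_of_integrable ?_ (hi1 i) (hi3 i)
      (fun x _ => (hφ x).mul (hcoord i x)) (fun x _ => hu x)
    simp_rw [hfd]
    exact hi2 i
  have hL : ∀ x, φ x • fderiv ℝ u x x = ∑ i, (φ x * x i) • fderiv ℝ u x (e i) := by
    intro x
    have h1 : fderiv ℝ u x x = fderiv ℝ u x (∑ i, x i • e i) := congrArg _ (hx x)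
    rw [h1, map_sum, Finset.smul_sum]
    simp [mul_smul]
  have hR : ∀ x, (d * φ x + fderiv ℝ φ x x) • u x
      = ∑ i, (φ x + x i * fderiv ℝ φ x (e i)) • u x := by
    intro x
    have h1 : fderiv ℝ φ x x = fderiv ℝ φ x (∑ i, x i • e i) := congrArg _ (hx x)
    rw [← Finset.sum_smul, Finset.sum_add_distrib, h1, map_sum]
    simp
  simp_rw [hL, hR]
  rw [integral_finsetSum _ fun i _ => hi1 i, integral_finsetSum _ fun i _ => hi2 i,
    ← Finset.sum_neg_distrib]
  exact Finset.sum_congr rfl fun i _ => hibp i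

/-- Integration by parts against the vector field `x ↦ k (‖x‖ ^ 2 + η) • x`, where `ψ` is minus
the logarithmic derivative of `k` in the logarithmic scale. -/
theorem integral_radial_smul_fderiv_self_eq {F : Type*} [NormedAddCommGroup F] [NormedSpace ℝ F]
    {k ψ : ℝ → ℝ} {C η : ℝ} (hη : 0 < η) (hk : ∀ s, 0 < s → HasDerivAt k (-(ψ s * k s / s)) s)
    (hψ0 : ∀ s, 0 < s → 0 ≤ ψ s) (hψ1 : ∀ s, 0 < s → ψ s ≤ 1) (hk0 : ∀ s, 0 < s → 0 ≤ k s)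
    (hkC : ∀ s, η ≤ s → k s * √s ≤ C) {u : 𝔼 → F} (hu : Differentiable ℝ u)
    (hui : Integrable u) (hu' : Integrable (fderiv ℝ u)) :
    ∫ x, k (‖x‖ ^ 2 + η) • fderiv ℝ u x x = -∫ x, ((d - 2 * ψ (‖x‖ ^ 2 + η) *
      (‖x‖ ^ 2 / (‖x‖ ^ 2 + η))) * k (‖x‖ ^ 2 + η)) • u x := by
  have hs : ∀ x : 𝔼, 0 < ‖x‖ ^ 2 + η := fun x => by positivity
  have hηs : ∀ x : 𝔼, η ≤ ‖x‖ ^ 2 + η := fun x => by nlinarith [sq_nonneg ‖x‖]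
  have hns : ∀ x : 𝔼, ‖x‖ ≤ √(‖x‖ ^ 2 + η) := fun x => Real.le_sqrt_of_sq_le (by linarith)
  have hfd : ∀ x : 𝔼, HasFDerivAt (fun x : 𝔼 => k (‖x‖ ^ 2 + η))
      ((-(ψ (‖x‖ ^ 2 + η) * k (‖x‖ ^ 2 + η) / (‖x‖ ^ 2 + η))) • (2 • innerSL ℝ x)) x := by
    intro x
    have h1 : HasFDerivAt (fun x : 𝔼 => ‖x‖ ^ 2 + η) (2 • innerSL ℝ x) x :=
      (hasStrictFDerivAt_norm_sq x).hasFDerivAt.add_const η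
    exact (hk _ (hs x)).comp_hasFDerivAt x h1
  have hφ2 : ∀ x : 𝔼, |k (‖x‖ ^ 2 + η)| * ‖x‖ ≤ C := fun x => by
    rw [abs_of_nonneg (hk0 _ (hs x))]
    exact (mul_le_mul_of_nonneg_left (hns x) (hk0 _ (hs x))).trans (hkC _ (hηs x))
  have hφ1 : ∀ x : 𝔼, |k (‖x‖ ^ 2 + η)| ≤ C / √η := fun x => by
    rw [abs_of_nonneg (hk0 _ (hs x)), le_div_iff₀ (by positivity)]
    exact (mul_le_mul_of_nonneg_left (Real.sqrt_le_sqrt (hηs x)) (hk0 _ (hs x))).trans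
      (hkC _ (hηs x))
  rw [integral_smul_fderiv_self_eq (C₁ := C / √η) (C₂ := C) (C₃ := 2 * (C / √η))
    (fun x => (hfd x).differentiableAt) hφ1 hφ2 ?_ hu hui hu']
  · congr 1
    refine integral_congr_ae (.of_forall fun x => ?_)
    simp only
    congr 1
    rw [(hfd x).fderiv]
    have := (hs x).ne'
    simp
    field_simp
    ring
  · intro x
    rw [(hfd x).fderiv, norm_smul, ← Nat.cast_smul_eq_nsmul ℝ, norm_smul, innerSL_apply_norm,
      Real.norm_eq_abs, abs_neg, abs_div, abs_mul, abs_of_nonneg (hψ0 _ (hs x)),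
      abs_of_pos (hs x)]
    have h1 : ‖x‖ ^ 2 / (‖x‖ ^ 2 + η) ≤ 1 := by
      rw [div_le_one (hs x)]; linarith
    calc _ = 2 * ((ψ (‖x‖ ^ 2 + η) * |k (‖x‖ ^ 2 + η)|) * (‖x‖ ^ 2 / (‖x‖ ^ 2 + η))) := by
            simp; ring
      _ ≤ 2 * ((1 * (C / √η)) * 1) := by
        have h0 : 0 ≤ C / √η := (abs_nonneg _).trans (hφ1 x)
        gcongr
        · exact hψ1 _ (hs x)
        · exact hφ1 x
      _ = _ := by ring

theorem SchwartzMap.memLp_fderiv (v : 𝓢(𝔼, ℂ)) : MemLp (fderiv ℝ v) 2 := by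
  have h : fderiv ℝ v = SchwartzMap.fderivCLM ℝ 𝔼 ℂ v :=
    funext fun x => (SchwartzMap.fderivCLM_apply ℝ v x).symm
  rw [h]
  exact (SchwartzMap.fderivCLM ℝ 𝔼 ℂ v).memLp 2

theorem SchwartzMap.memLp_div_sqrt {η : ℝ} (hη : 0 < η) (v : 𝓢(𝔼, ℂ)) :
    MemLp (fun x : 𝔼 => ‖v x‖ / √(‖x‖ ^ 2 + η)) 2 := by
  refine MemLp.of_le_mul (c := 1 / √η) (v.memLp 2) ?_ (.of_forall fun x => ?_)
  · refine (Continuous.div (by fun_prop) (by fun_prop) fun x => ?_).aestronglyMeasurable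
    positivity
  · rw [norm_div, norm_norm, Real.norm_of_nonneg (Real.sqrt_nonneg _), div_mul_eq_mul_div, one_mul]
    gcongr
    nlinarith [sq_nonneg ‖x‖]

theorem integral_radial_smul_inner_eq {k ψ : ℝ → ℝ} {C η : ℝ} (hη : 0 < η)
    (hk : ∀ s, 0 < s → HasDerivAt k (-(ψ s * k s / s)) s)
    (hψ0 : ∀ s, 0 < s → 0 ≤ ψ s) (hψ1 : ∀ s, 0 < s → ψ s ≤ 1) (hk0 : ∀ s, 0 < s → 0 ≤ k s)
    (hkC : ∀ s, η ≤ s → k s * √s ≤ C) (v w : 𝓢(𝔼, ℂ)) :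
    ∫ x, k (‖x‖ ^ 2 + η) • (⟪v x, fderiv ℝ w x x⟫_ℂ + ⟪fderiv ℝ v x x, w x⟫_ℂ)
      = -∫ x, ((d - 2 * ψ (‖x‖ ^ 2 + η) * (‖x‖ ^ 2 / (‖x‖ ^ 2 + η))) * k (‖x‖ ^ 2 + η)) •
        ⟪v x, w x⟫_ℂ := by
  have hfd : ∀ x y, fderiv ℝ (fun x => ⟪v x, w x⟫_ℂ) x y
      = ⟪v x, fderiv ℝ w x y⟫_ℂ + ⟪fderiv ℝ v x y, w x⟫_ℂ := fun x y =>
    fderiv_inner_apply ℂ v.differentiableAt w.differentiableAt y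
  have hsm : ContDiff ℝ 1 (fun x => ⟪v x, w x⟫_ℂ) := (v.smooth 1).inner ℂ (w.smooth 1)
  have h := integral_radial_smul_fderiv_self_eq (u := fun x => ⟪v x, w x⟫_ℂ) hη hk hψ0 hψ1 hk0 hkC
    (hsm.differentiable (by norm_num)) ?_ ?_
  · simp_rw [hfd] at h
    exact h
  · refine ((v.memLp 2).norm.integrable_mul (w.memLp 2).norm).mono'
      hsm.continuous.aestronglyMeasurable (.of_forall fun x => norm_inner_le_norm _ _)
  · refine (((v.memLp 2).norm.integrable_mul w.memLp_fderiv.norm).add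
      (v.memLp_fderiv.norm.integrable_mul (w.memLp 2).norm)).mono'
      (hsm.continuous_fderiv (by norm_num)).aestronglyMeasurable (.of_forall fun x => ?_)
    refine ContinuousLinearMap.opNorm_le_bound _ (by simp; positivity) fun y => ?_
    rw [hfd]
    simp only [Pi.add_apply, Pi.mul_apply]
    calc _ ≤ ‖v x‖ * (‖fderiv ℝ w x‖ * ‖y‖) + (‖fderiv ℝ v x‖ * ‖y‖) * ‖w x‖ := by
          refine (norm_add_le _ _).trans (add_le_add ?_ ?_)
          · refine (norm_inner_le_norm _ _).trans ?_
            gcongr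
            exact ContinuousLinearMap.le_opNorm _ _
          · refine (norm_inner_le_norm _ _).trans ?_
            gcongr
            exact ContinuousLinearMap.le_opNorm _ _
      _ = _ := by ring

/-- A regularized Hardy inequality. -/
theorem hardy_regularized (hd : 3 ≤ d) {η : ℝ} (hη : 0 < η) (v : 𝓢(𝔼, ℂ)) :
    (d - 2) * √(∫ x : 𝔼, (‖v x‖ / √(‖x‖ ^ 2 + η)) ^ 2) ≤ 2 * √(∫ x, ‖fderiv ℝ v x‖ ^ 2) := by
  have hd' : (3 : ℝ) ≤ d := by exact_mod_cast hd
  have hs : ∀ x : 𝔼, 0 < ‖x‖ ^ 2 + η := fun x => by positivity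
  have hns : ∀ x : 𝔼, ‖x‖ ≤ √(‖x‖ ^ 2 + η) := fun x => Real.le_sqrt_of_sq_le (by linarith)
  have hss : ∀ x : 𝔼, √(‖x‖ ^ 2 + η) ^ 2 = ‖x‖ ^ 2 + η := fun x => Real.sq_sqrt (hs x).le
  have hm := SchwartzMap.memLp_div_sqrt hη v
  have hCS := integral_mul_le_sqrt_mul_sqrt (fun x : 𝔼 => by positivity)
    (fun x => norm_nonneg (fderiv ℝ v x)) hm v.memLp_fderiv.norm
  have hibp := integral_radial_smul_inner_eq (k := fun s => 1 / s) (ψ := fun _ => 1) (C := 1 / √η)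
    hη (fun s hs => by
      convert! (hasDerivAt_inv hs.ne') using 1
      · ext; simp
      · field_simp) (fun _ _ => zero_le_one) (fun _ _ => le_rfl)
    (fun s hs => by positivity) (fun s hs => by
      have hs0 : 0 < s := hη.trans_le hs
      have : 1 / s * √s = 1 / √s := by
        rw [div_mul_eq_mul_div, one_mul, Real.sqrt_div_self', ]
      rw [this]
      gcongr) v v
  set I := ∫ x : 𝔼, (‖v x‖ / √(‖x‖ ^ 2 + η)) ^ 2
  have hI0 : 0 ≤ I := integral_nonneg fun x => by positivity
  have hub : ‖∫ x, ((d - 2 * 1 * (‖x‖ ^ 2 / (‖x‖ ^ 2 + η))) * (1 / (‖x‖ ^ 2 + η))) •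
      ⟪v x, v x⟫_ℂ‖ ≤ 2 * ∫ x : 𝔼, ‖v x‖ / √(‖x‖ ^ 2 + η) * ‖fderiv ℝ v x‖ := by
    rw [← norm_neg, ← hibp, ← integral_const_mul]
    refine norm_integral_le_of_norm_le ((hm.integrable_mul v.memLp_fderiv.norm).const_mul 2)
      (.of_forall fun x => ?_)
    rw [norm_smul, Real.norm_of_nonneg (one_div_nonneg.2 (hs x).le)]
    have h1 : ‖⟪v x, fderiv ℝ v x x⟫_ℂ + ⟪fderiv ℝ v x x, v x⟫_ℂ‖
        ≤ 2 * (‖v x‖ * (‖fderiv ℝ v x‖ * √(‖x‖ ^ 2 + η))) := by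
      refine (norm_add_le _ _).trans ?_
      rw [norm_inner_symm (fderiv ℝ v x x), ← two_mul]
      gcongr
      refine (norm_inner_le_norm _ _).trans ?_
      gcongr
      exact (ContinuousLinearMap.le_opNorm _ _).trans (by gcongr; exact hns x)
    calc _ ≤ 1 / (‖x‖ ^ 2 + η) * (2 * (‖v x‖ * (‖fderiv ℝ v x‖ * √(‖x‖ ^ 2 + η)))) := by
          gcongr
      _ = _ := by
          have := Real.sqrt_pos.2 (hs x)
          rw [← hss x, Real.sqrt_sq this.le]
          field_simp
  have hlb : (d - 2) * I ≤ ‖∫ x, ((d - 2 * 1 * (‖x‖ ^ 2 / (‖x‖ ^ 2 + η))) *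
      (1 / (‖x‖ ^ 2 + η))) • ⟪v x, v x⟫_ℂ‖ := by
    have h1 : ∀ x : 𝔼, ((d - 2 * 1 * (‖x‖ ^ 2 / (‖x‖ ^ 2 + η))) * (1 / (‖x‖ ^ 2 + η))) •
        ⟪v x, v x⟫_ℂ = (((d - 2 * 1 * (‖x‖ ^ 2 / (‖x‖ ^ 2 + η))) *
          (‖v x‖ / √(‖x‖ ^ 2 + η)) ^ 2 : ℝ) : ℂ) := by
      intro x
      rw [inner_self_eq_norm_sq_to_K, div_pow, hss]
      simp only [Complex.real_smul, Complex.coe_algebraMap]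
      push_cast
      ring
    have hfrac : ∀ x : 𝔼, ‖x‖ ^ 2 / (‖x‖ ^ 2 + η) ≤ 1 := fun x => by
      rw [div_le_one (hs x)]; linarith
    have hfrac0 : ∀ x : 𝔼, 0 ≤ ‖x‖ ^ 2 / (‖x‖ ^ 2 + η) := fun x =>
      div_nonneg (by positivity) (hs x).le
    simp_rw [h1]
    rw [integral_complex_ofReal, Complex.norm_real, ← integral_const_mul]
    refine le_trans ?_ (le_abs_self _)
    have hsq := hm.integrable_sq
    refine integral_mono (hsq.const_mul _) ?_ fun x => ?_
    · refine hsq.bdd_mul (c := d) ?_ (.of_forall fun x => ?_)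
      · refine (Continuous.sub (by fun_prop) (Continuous.mul (by fun_prop)
          (Continuous.div (by fun_prop) (by fun_prop) fun x => (hs x).ne'))).aestronglyMeasurable
      · rw [Real.norm_of_nonneg (by linarith [hfrac x])]
        linarith [hfrac0 x]
    · simp only
      gcongr
      linarith [hfrac x]
  have hfinal : (d - 2) * √I * √I ≤ 2 * √(∫ x, ‖fderiv ℝ v x‖ ^ 2) * √I := by
    rw [mul_assoc, Real.mul_self_sqrt hI0]
    linarith
  rcases (Real.sqrt_nonneg I).lt_or_eq with h | h
  · exact le_of_mul_le_mul_right hfinal h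
  · rw [← h]
    simp

theorem norm_integral_radial_regularized_le (hd : 3 ≤ d) {k ψ : ℝ → ℝ} {η : ℝ} (hη : 0 < η)
    (hk : ∀ s, 0 < s → HasDerivAt k (-(ψ s * k s / s)) s)
    (hψ0 : ∀ s, 0 < s → 0 ≤ ψ s) (hψ1 : ∀ s, 0 < s → ψ s ≤ 1) (hk0 : ∀ s, 0 < s → 0 ≤ k s)
    (hkC : ∀ s, 0 < s → k s * √s ≤ 1) (v w : 𝓢(𝔼, ℂ)) :
    ‖∫ x, k (‖x‖ ^ 2 + η) • ⟪v x, fderiv ℝ w x x⟫_ℂ‖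
      ≤ 7 * (√(∫ x, ‖fderiv ℝ v x‖ ^ 2) * √(∫ x, ‖w x‖ ^ 2)) := by
  have hd' : (3 : ℝ) ≤ d := by exact_mod_cast hd
  have hs : ∀ x : 𝔼, 0 < ‖x‖ ^ 2 + η := fun x => by positivity
  have hns : ∀ x : 𝔼, ‖x‖ ≤ √(‖x‖ ^ 2 + η) := fun x => Real.le_sqrt_of_sq_le (by linarith)
  have hkx : ∀ x : 𝔼, k (‖x‖ ^ 2 + η) * ‖x‖ ≤ 1 := fun x =>
    (mul_le_mul_of_nonneg_left (hns x) (hk0 _ (hs x))).trans (hkC _ (hs x))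
  have hm := SchwartzMap.memLp_div_sqrt hη v
  have hkc : Continuous (fun x : 𝔼 => k (‖x‖ ^ 2 + η)) := by
    rw [continuous_iff_continuousAt]
    intro x
    exact ContinuousAt.comp (f := fun x : 𝔼 => ‖x‖ ^ 2 + η) (hk _ (hs x)).continuousAt
      (by fun_prop)
  have hcont : ∀ u : 𝓢(𝔼, ℂ), Continuous (fun x => fderiv ℝ u x x) := fun u =>
    ((u.smooth 1).continuous_fderiv (by norm_num)).clm_apply continuous_id
  have hbd : ∀ (u : 𝓢(𝔼, ℂ)) x, k (‖x‖ ^ 2 + η) * ‖fderiv ℝ u x x‖ ≤ ‖fderiv ℝ u x‖ := by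
    intro u x
    calc _ ≤ k (‖x‖ ^ 2 + η) * (‖fderiv ℝ u x‖ * ‖x‖) := by
          gcongr
          · exact hk0 _ (hs x)
          · exact ContinuousLinearMap.le_opNorm _ _
      _ = (k (‖x‖ ^ 2 + η) * ‖x‖) * ‖fderiv ℝ u x‖ := by ring
      _ ≤ 1 * ‖fderiv ℝ u x‖ := by gcongr; exact hkx x
      _ = _ := one_mul _
  have hb1 : ∀ x, ‖k (‖x‖ ^ 2 + η) • ⟪v x, fderiv ℝ w x x⟫_ℂ‖ ≤ ‖v x‖ * ‖fderiv ℝ w x‖ := by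
    intro x
    rw [norm_smul, Real.norm_of_nonneg (hk0 _ (hs x))]
    calc _ ≤ k (‖x‖ ^ 2 + η) * (‖v x‖ * ‖fderiv ℝ w x x‖) := by
          gcongr
          · exact hk0 _ (hs x)
          · exact norm_inner_le_norm _ _
      _ = ‖v x‖ * (k (‖x‖ ^ 2 + η) * ‖fderiv ℝ w x x‖) := by ring
      _ ≤ _ := by gcongr; exact hbd w x
  have hb2 : ∀ x, ‖k (‖x‖ ^ 2 + η) • ⟪fderiv ℝ v x x, w x⟫_ℂ‖ ≤ ‖fderiv ℝ v x‖ * ‖w x‖ := by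
    intro x
    rw [norm_smul, Real.norm_of_nonneg (hk0 _ (hs x))]
    calc _ ≤ k (‖x‖ ^ 2 + η) * (‖fderiv ℝ v x x‖ * ‖w x‖) := by
          gcongr
          · exact hk0 _ (hs x)
          · exact norm_inner_le_norm _ _
      _ = (k (‖x‖ ^ 2 + η) * ‖fderiv ℝ v x x‖) * ‖w x‖ := by ring
      _ ≤ _ := by gcongr; exact hbd v x
  have hi1 : Integrable (fun x => k (‖x‖ ^ 2 + η) • ⟪v x, fderiv ℝ w x x⟫_ℂ) :=
    ((v.memLp 2).norm.integrable_mul w.memLp_fderiv.norm).mono'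
      (hkc.smul (v.continuous.inner (hcont w))).aestronglyMeasurable (.of_forall hb1)
  have hi2 : Integrable (fun x => k (‖x‖ ^ 2 + η) • ⟪fderiv ℝ v x x, w x⟫_ℂ) :=
    (v.memLp_fderiv.norm.integrable_mul (w.memLp 2).norm).mono'
      (hkc.smul ((hcont v).inner w.continuous)).aestronglyMeasurable (.of_forall hb2)
  have hibp := integral_radial_smul_inner_eq hη hk hψ0 hψ1 hk0
    (fun s hs => hkC s (hη.trans_le hs)) v w
  simp_rw [smul_add] at hibp
  rw [integral_add hi1 hi2] at hibp
  rw [eq_sub_of_add_eq hibp]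
  have hA : ‖∫ x, ((d - 2 * ψ (‖x‖ ^ 2 + η) * (‖x‖ ^ 2 / (‖x‖ ^ 2 + η))) * k (‖x‖ ^ 2 + η)) •
        ⟪v x, w x⟫_ℂ‖ ≤ d * ∫ x : 𝔼, ‖v x‖ / √(‖x‖ ^ 2 + η) * ‖w x‖ := by
    rw [← integral_const_mul]
    refine norm_integral_le_of_norm_le ((hm.integrable_mul (w.memLp 2).norm).const_mul _)
      (.of_forall fun x => ?_)
    have hf1 : ‖x‖ ^ 2 / (‖x‖ ^ 2 + η) ≤ 1 := by rw [div_le_one (hs x)]; linarith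
    have hf0 : 0 ≤ ‖x‖ ^ 2 / (‖x‖ ^ 2 + η) := div_nonneg (by positivity) (hs x).le
    have hp0 := hψ0 _ (hs x)
    have hpf0 := mul_nonneg hp0 hf0
    have hpf1 := mul_le_one₀ (hψ1 _ (hs x)) hf0 hf1
    have hk1 : k (‖x‖ ^ 2 + η) ≤ 1 / √(‖x‖ ^ 2 + η) := by
      rw [le_div_iff₀ (Real.sqrt_pos.2 (hs x))]
      exact hkC _ (hs x)
    rw [norm_smul, norm_mul, Real.norm_of_nonneg (hk0 _ (hs x)),
      Real.norm_of_nonneg (by nlinarith)]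
    calc _ ≤ (d * (1 / √(‖x‖ ^ 2 + η))) * (‖v x‖ * ‖w x‖) := by
          gcongr
          · exact hk0 _ (hs x)
          · nlinarith
          · exact norm_inner_le_norm _ _
      _ = _ := by ring
  have hB : ‖∫ x, k (‖x‖ ^ 2 + η) • ⟪fderiv ℝ v x x, w x⟫_ℂ‖ ≤ ∫ x, ‖fderiv ℝ v x‖ * ‖w x‖ :=
    norm_integral_le_of_norm_le (v.memLp_fderiv.norm.integrable_mul (w.memLp 2).norm)
      (.of_forall hb2)
  have hCS1 := integral_mul_le_sqrt_mul_sqrt (fun x : 𝔼 => by positivity)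
    (fun x => norm_nonneg (w x)) hm (w.memLp 2).norm
  have hCS2 := integral_mul_le_sqrt_mul_sqrt (fun x => norm_nonneg (fderiv ℝ v x))
    (fun x => norm_nonneg (w x)) v.memLp_fderiv.norm (w.memLp 2).norm
  have hH := hardy_regularized hd hη v
  refine (norm_sub_le _ _).trans ?_
  rw [norm_neg]
  set I := √(∫ x : 𝔼, (‖v x‖ / √(‖x‖ ^ 2 + η)) ^ 2)
  set J := √(∫ x, ‖fderiv ℝ v x‖ ^ 2)
  set N := √(∫ x, ‖w x‖ ^ 2)
  have hI : 0 ≤ I := Real.sqrt_nonneg _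
  have hN : 0 ≤ N := Real.sqrt_nonneg _
  have hdI : d * I ≤ 6 * J := by nlinarith
  calc _ ≤ d * (I * N) + J * N := by
        refine add_le_add (hA.trans ?_) (hB.trans hCS2)
        gcongr
    _ = (d * I) * N + J * N := by ring
    _ ≤ (6 * J) * N + J * N := by gcongr
    _ = _ := by ring

theorem hasDerivAt_rpow_div_one_add_rpow (p : ℝ) {s : ℝ} (hs : 0 < s) :
    HasDerivAt (fun s : ℝ => s ^ (p - 1 / 2) / (1 + s ^ p))
      (-(((1 / 2 - p) + s ^ p / 2) / (1 + s ^ p) * (s ^ (p - 1 / 2) / (1 + s ^ p)) / s)) s := by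
  have hp : 0 < 1 + s ^ p := by positivity
  have h1 := (Real.hasDerivAt_rpow_const (p := p - 1 / 2) (Or.inl hs.ne')).div
    ((Real.hasDerivAt_rpow_const (p := p) (Or.inl hs.ne')).const_add 1) hp.ne'
  convert! h1 using 1
  rw [Real.rpow_sub_one hs.ne', Real.rpow_sub_one hs.ne']
  field_simp
  ring

/-- The endpoint bound in which the derivative is moved to the other factor. -/
theorem norm_integral_inner_radial_deriv_le (hd : 3 ≤ d) {ε : ℝ} (hε0 : 0 < ε) (hε1 : ε < 1)
    (v w : 𝓢(𝔼, ℂ)) :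
    ‖∫ x, ⟪v x, ((‖x‖ ^ ε / (1 + ‖x‖ ^ ε) : ℝ) : ℂ) * fderiv ℝ w x (‖x‖⁻¹ • x)⟫_ℂ‖
      ≤ 7 * (√(∫ x, ‖fderiv ℝ v x‖ ^ 2) * √(∫ x, ‖w x‖ ^ 2)) := by
  set p := ε / 2 with hp
  set k : ℝ → ℝ := fun s => s ^ (p - 1 / 2) / (1 + s ^ p) with hk
  set ψ : ℝ → ℝ := fun s => ((1 / 2 - p) + s ^ p / 2) / (1 + s ^ p)
  have hk' : ∀ s, 0 < s → HasDerivAt k (-(ψ s * k s / s)) s := fun s hs =>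
    hasDerivAt_rpow_div_one_add_rpow p hs
  have hk0 : ∀ s, 0 < s → 0 ≤ k s := fun s hs => by positivity
  have hψ0 : ∀ s, 0 < s → 0 ≤ ψ s := fun s hs => by
    have : 0 < 1 / 2 - p := by linarith
    positivity
  have hψ1 : ∀ s, 0 < s → ψ s ≤ 1 := fun s hs => by
    have : 0 < s ^ p := by positivity
    rw [div_le_one (by positivity)]
    linarith
  have hkC : ∀ s, 0 < s → k s * √s ≤ 1 := fun s hs => by
    have h1 : s ^ (p - 1 / 2) * √s = s ^ p := by
      rw [Real.sqrt_eq_rpow, ← Real.rpow_add hs]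
      congr 1
      ring
    simp only [hk]
    rw [div_mul_eq_mul_div, h1, div_le_one (by positivity)]
    linarith
  have hkc : ∀ η, 0 < η → Continuous (fun x : 𝔼 => k (‖x‖ ^ 2 + η)) := fun η hη => by
    rw [continuous_iff_continuousAt]
    intro x
    exact ContinuousAt.comp (f := fun x : 𝔼 => ‖x‖ ^ 2 + η)
      (hk' _ (by positivity)).continuousAt (by fun_prop)
  have hlim : Tendsto (fun η : ℝ => ∫ x, k (‖x‖ ^ 2 + η) • ⟪v x, fderiv ℝ w x x⟫_ℂ) (𝓝[>] 0)
      (𝓝 (∫ x, ⟪v x, ((‖x‖ ^ ε / (1 + ‖x‖ ^ ε) : ℝ) : ℂ) * fderiv ℝ w x (‖x‖⁻¹ • x)⟫_ℂ)) := by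
    refine tendsto_integral_filter_of_dominated_convergence (fun x => ‖v x‖ * ‖fderiv ℝ w x‖)
      ?_ ?_ ((v.memLp 2).norm.integrable_mul w.memLp_fderiv.norm) (.of_forall fun x => ?_)
    · filter_upwards [self_mem_nhdsWithin] with η hη
      exact ((hkc η hη).smul (v.continuous.inner (((w.smooth 1).continuous_fderiv
        (by norm_num)).clm_apply continuous_id))).aestronglyMeasurable
    · filter_upwards [self_mem_nhdsWithin] with η hη
      refine .of_forall fun x => ?_
      have hη' : 0 < η := hη
      have hs : 0 < ‖x‖ ^ 2 + η := by positivity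
      rw [norm_smul, Real.norm_of_nonneg (hk0 _ hs)]
      calc _ ≤ k (‖x‖ ^ 2 + η) * (‖v x‖ * (‖fderiv ℝ w x‖ * √(‖x‖ ^ 2 + η))) := by
            have := hk0 _ hs
            gcongr
            refine (norm_inner_le_norm _ _).trans ?_
            gcongr
            refine (ContinuousLinearMap.le_opNorm _ _).trans ?_
            gcongr
            exact Real.le_sqrt_of_sq_le (by linarith)
        _ = (k (‖x‖ ^ 2 + η) * √(‖x‖ ^ 2 + η)) * (‖v x‖ * ‖fderiv ℝ w x‖) := by ring
        _ ≤ 1 * (‖v x‖ * ‖fderiv ℝ w x‖) := by gcongr; exact hkC _ hs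
        _ = _ := one_mul _
    · rcases eq_or_ne x 0 with rfl | hx
      · simp
      · have hx0 : 0 < ‖x‖ := norm_pos_iff.2 hx
        have h1 : ⟪v x, ((‖x‖ ^ ε / (1 + ‖x‖ ^ ε) : ℝ) : ℂ) * fderiv ℝ w x (‖x‖⁻¹ • x)⟫_ℂ
            = k (‖x‖ ^ 2 + 0) • ⟪v x, fderiv ℝ w x x⟫_ℂ := by
          have e1 : (‖x‖ ^ 2) ^ p = ‖x‖ ^ ε := by
            rw [← Real.rpow_natCast_mul hx0.le]
            congr 1
            rw [hp]; push_cast; ring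
          have e2 : (‖x‖ ^ 2) ^ (p - 1 / 2) = ‖x‖ ^ ε * ‖x‖⁻¹ := by
            rw [← Real.rpow_natCast_mul hx0.le, ← Real.rpow_neg_one, ← Real.rpow_add hx0]
            congr 1
            rw [hp]; push_cast; ring
          simp only [hk, add_zero, e1, e2, map_smul, RCLike.inner_apply, Complex.real_smul]
          push_cast
          ring
        rw [h1]
        refine Tendsto.smul ?_ tendsto_const_nhds
        have hx2 : 0 < ‖x‖ ^ 2 := by positivity
        have h2 : ContinuousAt (k ∘ fun η => ‖x‖ ^ 2 + η) 0 :=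
          ContinuousAt.comp (by simpa using (hk' _ hx2).continuousAt) (by fun_prop)
        exact h2.tendsto.mono_left nhdsWithin_le_nhds
  refine le_of_tendsto hlim.norm ?_
  filter_upwards [self_mem_nhdsWithin] with η hη
  exact norm_integral_radial_regularized_le hd hη hk' hψ0 hψ1 hk0 hkC v w

theorem SchwartzMap.fourier_fourierMultiplierCLM_ofReal_apply {g : 𝔼 → ℝ}
    (hg : g.HasTemperateGrowth) (f : 𝓢(𝔼, ℂ)) (ξ : 𝔼) :
    𝓕 (fourierMultiplierCLM ℂ (fun ξ => (g ξ : ℂ)) f) ξ = g ξ * 𝓕 f ξ := by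
  have hg' : (fun ξ => (g ξ : ℂ)).HasTemperateGrowth := by fun_prop
  rw [fourierMultiplierCLM_apply, FourierTransform.fourier_fourierInv_eq,
    smulLeftCLM_apply_apply hg', smul_eq_mul]

theorem SchwartzMap.norm_toLp_two_sq (f : 𝓢(𝔼, ℂ)) :
    ‖f.toLp 2‖ ^ 2 = ∫ ξ, ‖𝓕 f ξ‖ ^ 2 := by
  rw [integral_norm_sq_fourier, norm_toLp' (by norm_num) (by norm_num), ENNReal.toReal_ofNat,
    ← one_div, ← Real.sqrt_eq_rpow, Real.sq_sqrt (by positivity)]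
  simp_rw [Real.rpow_ofNat]

theorem SchwartzMap.inner_toLp_fourierMultiplierCLM {g : 𝔼 → ℝ}
    (hg : g.HasTemperateGrowth) (s t : 𝓢(𝔼, ℂ)) :
    ⟪s.toLp 2, (fourierMultiplierCLM ℂ (fun ξ => (g ξ : ℂ)) t).toLp 2⟫_ℂ =
      ∫ ξ, g ξ * ⟪𝓕 s ξ, 𝓕 t ξ⟫_ℂ := by
  rw [← inner_fourier_toL2_eq, inner_toL2_toL2_eq _ _ volume]
  refine integral_congr_ae (.of_forall fun ξ => ?_)
  simp only [fourier_fourierMultiplierCLM_ofReal_apply hg, RCLike.inner_apply]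
  ring

theorem SchwartzMap.inner_fourierMultiplierCLM_toLp {g : 𝔼 → ℝ}
    (hg : g.HasTemperateGrowth) (s t : 𝓢(𝔼, ℂ)) :
    ⟪(fourierMultiplierCLM ℂ (fun ξ => (g ξ : ℂ)) s).toLp 2, t.toLp 2⟫_ℂ =
      ∫ ξ, g ξ * ⟪𝓕 s ξ, 𝓕 t ξ⟫_ℂ := by
  rw [← inner_fourier_toL2_eq, inner_toL2_toL2_eq _ _ volume]
  refine integral_congr_ae (.of_forall fun ξ => ?_)
  simp only [fourier_fourierMultiplierCLM_ofReal_apply hg, RCLike.inner_apply, map_mul,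
    Complex.conj_ofReal]
  ring

theorem SchwartzMap.re_inner_toLp_fourierMultiplierCLM {g : 𝔼 → ℝ}
    (hg : g.HasTemperateGrowth) (s : 𝓢(𝔼, ℂ)) :
    (⟪s.toLp 2, (fourierMultiplierCLM ℂ (fun ξ => (g ξ : ℂ)) s).toLp 2⟫_ℂ).re =
      ∫ ξ, g ξ * ‖𝓕 s ξ‖ ^ 2 := by
  have : ∀ ξ, g ξ * ⟪𝓕 s ξ, 𝓕 s ξ⟫_ℂ = ((g ξ * ‖𝓕 s ξ‖ ^ 2 : ℝ) : ℂ) := fun ξ => by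
    rw [inner_self_eq_norm_sq_to_K]; simp
  simp_rw [inner_toLp_fourierMultiplierCLM hg, this]
  rw [integral_complex_ofReal, Complex.ofReal_re]

theorem SchwartzMap.norm_toLp_fourierMultiplierCLM_sq {g : 𝔼 → ℝ}
    (hg : g.HasTemperateGrowth) (f : 𝓢(𝔼, ℂ)) :
    ‖(fourierMultiplierCLM ℂ (fun ξ => (g ξ : ℂ)) f).toLp 2‖ ^ 2 =
      ∫ ξ, g ξ ^ 2 * ‖𝓕 f ξ‖ ^ 2 := by
  simp_rw [norm_toLp_two_sq, fourier_fourierMultiplierCLM_ofReal_apply hg, norm_mul, mul_pow]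
  simp

theorem SchwartzMap.integrable_norm_sq (f : 𝓢(𝔼, ℂ)) : Integrable fun x => ‖f x‖ ^ 2 :=
  (memLp_two_iff_integrable_sq_norm f.continuous.aestronglyMeasurable).1 (f.memLp 2)

theorem SchwartzMap.integrable_sq_mul_norm_sq {g : 𝔼 → ℝ} (hg : g.HasTemperateGrowth)
    (f : 𝓢(𝔼, ℂ)) : Integrable fun x => g x ^ 2 * ‖f x‖ ^ 2 := by
  refine (integrable_norm_sq (smulLeftCLM ℂ g f)).congr (.of_forall fun x => ?_)
  simp [smulLeftCLM_apply_apply hg, mul_pow]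

theorem ContinuousLinearMap.opNorm_sq_le_sum (L : 𝔼 →L[ℝ] ℂ) :
    ‖L‖ ^ 2 ≤ ∑ i, ‖L (EuclideanSpace.single i 1)‖ ^ 2 := by
  have h : ‖L‖ ≤ √(∑ i, ‖L (EuclideanSpace.single i 1)‖ ^ 2) := by
    refine L.opNorm_le_bound (by positivity) fun x => ?_
    have hx : x = ∑ i, x i • EuclideanSpace.single i (1 : ℝ) := by
      simpa using ((EuclideanSpace.basisFun (Fin d) ℝ).sum_repr x).symm
    calc ‖L x‖ = ‖∑ i, x i • L (EuclideanSpace.single i 1)‖ := by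
          conv_lhs => rw [hx]
          simp only [map_sum, map_smul]
      _ ≤ ∑ i, ‖L (EuclideanSpace.single i 1)‖ * ‖x i‖ := by
          refine (norm_sum_le _ _).trans (Finset.sum_le_sum fun i _ => ?_)
          rw [norm_smul, mul_comm]
      _ ≤ _ := by
          rw [EuclideanSpace.norm_eq]
          exact Real.sum_mul_le_sqrt_mul_sqrt _ _ _
  calc _ ≤ (√(∑ i, ‖L (EuclideanSpace.single i 1)‖ ^ 2)) ^ 2 := by gcongr
    _ = _ := Real.sq_sqrt (by positivity)

theorem SchwartzMap.integral_norm_fderiv_sq_le {g : 𝔼 → ℝ}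
    (hg : g.HasTemperateGrowth) (hgξ : ∀ ξ, 2 * π * ‖ξ‖ ≤ g ξ) (f : 𝓢(𝔼, ℂ)) :
    ∫ x, ‖fderiv ℝ f x‖ ^ 2 ≤
      ‖(fourierMultiplierCLM ℂ (fun ξ => (g ξ : ℂ)) f).toLp 2‖ ^ 2 := by
  have hF : ∀ (i : Fin d) (ξ : 𝔼), ‖𝓕 (∂_{EuclideanSpace.single i (1 : ℝ)} f) ξ‖ ^ 2 =
      (2 * π) ^ 2 * ‖ξ i‖ ^ 2 * ‖𝓕 f ξ‖ ^ 2 := fun i ξ => by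
    have : (inner ℝ · (EuclideanSpace.single i (1 : ℝ)) : 𝔼 → ℝ).HasTemperateGrowth := by fun_prop
    rw [fourier_lineDerivOp_eq, smul_apply, smulLeftCLM_apply_apply this]
    simp [EuclideanSpace.inner_single_right, mul_pow, abs_of_pos Real.pi_pos, mul_assoc]
  have hsq := fun i : Fin d => integrable_norm_sq (∂_{EuclideanSpace.single i (1 : ℝ)} f)
  have hsq' := fun i : Fin d => integrable_norm_sq (𝓕 (∂_{EuclideanSpace.single i (1 : ℝ)} f))
  calc ∫ x, ‖fderiv ℝ f x‖ ^ 2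
      ≤ ∫ x, ∑ i : Fin d, ‖∂_{EuclideanSpace.single i (1 : ℝ)} f x‖ ^ 2 := by
        refine integral_mono_of_nonneg (.of_forall fun x => by positivity)
          (integrable_finsetSum _ fun i _ => hsq i) (.of_forall fun x => ?_)
        exact (fderiv ℝ f x).opNorm_sq_le_sum
    _ = ∫ ξ, ∑ i : Fin d, ‖𝓕 (∂_{EuclideanSpace.single i (1 : ℝ)} f) ξ‖ ^ 2 := by
        rw [integral_finsetSum _ fun i _ => hsq i, integral_finsetSum _ fun i _ => hsq' i]
        simp_rw [integral_norm_sq_fourier]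
    _ ≤ ∫ ξ, g ξ ^ 2 * ‖𝓕 f ξ‖ ^ 2 := by
        refine integral_mono (integrable_finsetSum _ fun i _ => hsq' i)
          (integrable_sq_mul_norm_sq hg _) fun ξ => ?_
        simp_rw [hF, ← Finset.sum_mul, ← Finset.mul_sum, ← EuclideanSpace.norm_sq_eq, ← mul_pow]
        have := hgξ ξ
        gcongr
    _ = _ := (norm_toLp_fourierMultiplierCLM_sq hg f).symm

theorem norm_mul_fderiv_radial_le {a : 𝔼 → ℝ} (ha0 : ∀ x, 0 ≤ a x) (ha1 : ∀ x, a x ≤ 1)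
    (w : 𝔼 → ℂ) (x : 𝔼) :
    ‖(a x : ℂ) * fderiv ℝ w x (‖x‖⁻¹ • x)‖ ≤ ‖fderiv ℝ w x‖ := by
  rw [norm_mul, Complex.norm_real, Real.norm_of_nonneg (ha0 x)]
  have h : ‖‖x‖⁻¹ • x‖ ≤ 1 := by
    rw [norm_smul, norm_inv, norm_norm]
    exact inv_mul_le_one
  calc _ ≤ 1 * (‖fderiv ℝ w x‖ * 1) := by
        gcongr
        · exact ha1 x
        · exact (ContinuousLinearMap.le_opNorm _ _).trans (by gcongr)
    _ = _ := by ring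

theorem SchwartzMap.memLp_mul_fderiv_radial {a : 𝔼 → ℝ} (ham : Measurable a)
    (ha0 : ∀ x, 0 ≤ a x) (ha1 : ∀ x, a x ≤ 1) (w : 𝓢(𝔼, ℂ)) :
    MemLp (fun x => (a x : ℂ) * fderiv ℝ w x (‖x‖⁻¹ • x)) 2 := by
  refine w.memLp_fderiv.mono ?_ (.of_forall fun x => norm_mul_fderiv_radial_le ha0 ha1 w x)
  have h1 : Measurable fun x : 𝔼 => fderiv ℝ w x (‖x‖⁻¹ • x) := by
    have h : Continuous fun p : 𝔼 × 𝔼 => fderiv ℝ w p.1 p.2 :=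
      (((w.smooth 1).continuous_fderiv (by norm_num)).comp continuous_fst).clm_apply continuous_snd
    exact h.measurable.comp (measurable_id.prodMk (by fun_prop))
  exact ((Complex.measurable_ofReal.comp ham).mul h1).aestronglyMeasurable

theorem SchwartzMap.sq_norm_integral_le_of_multiplier (hd : 3 ≤ d) {ε : ℝ} (hε0 : 0 < ε)
    (hε1 : ε < 1) {g : 𝔼 → ℝ} (hg : g.HasTemperateGrowth)
    (hg' : (fun ξ => (g ξ)⁻¹).HasTemperateGrowth) {δ : ℝ} (hδ : 0 < δ) (hδg : ∀ ξ, δ ≤ g ξ)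
    (hgξ : ∀ ξ, 2 * π * ‖ξ‖ ≤ g ξ) (v w : 𝓢(𝔼, ℂ)) :
    ‖∫ x, ⟪v x, ((‖x‖ ^ ε / (1 + ‖x‖ ^ ε) : ℝ) : ℂ) * fderiv ℝ w x (‖x‖⁻¹ • x)⟫_ℂ‖ ^ 2 ≤
      7 * (∫ ξ, g ξ * ‖𝓕 v ξ‖ ^ 2) * ∫ ξ, g ξ * ‖𝓕 w ξ‖ ^ 2 := by
  have hg0 : ∀ ξ, 0 < g ξ := fun ξ => hδ.trans_le (hδg ξ)
  have ham : Measurable fun x : 𝔼 => ‖x‖ ^ ε / (1 + ‖x‖ ^ ε) := by fun_prop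
  have ha0 : ∀ x : 𝔼, 0 ≤ ‖x‖ ^ ε / (1 + ‖x‖ ^ ε) := fun x => by positivity
  have ha1 : ∀ x : 𝔼, ‖x‖ ^ ε / (1 + ‖x‖ ^ ε) ≤ 1 := fun x =>
    div_le_one_of_le₀ (by linarith) (by positivity)
  have hT := fun w : 𝓢(𝔼, ℂ) => memLp_mul_fderiv_radial ham ha0 ha1 w
  let T : 𝓢(𝔼, ℂ) →ₗ[ℂ] Lp ℂ 2 (volume : Measure 𝔼) :=
    { toFun w := (hT w).toLp
      map_add' w₁ w₂ := by
        rw [← MemLp.toLp_add]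
        refine MemLp.toLp_congr _ _ (.of_forall fun x => ?_)
        have : fderiv ℝ (⇑(w₁ + w₂)) x = fderiv ℝ w₁ x + fderiv ℝ w₂ x :=
          fderiv_add w₁.differentiableAt w₂.differentiableAt
        simp only [this, add_apply, Pi.add_apply, mul_add]
      map_smul' c w := by
        rw [RingHom.id_apply, ← MemLp.toLp_const_smul]
        refine MemLp.toLp_congr _ _ (.of_forall fun x => ?_)
        have : fderiv ℝ (⇑(c • w)) x = c • fderiv ℝ w x := fderiv_const_smul w.differentiableAt c
        simp only [this, smul_apply, Pi.smul_apply, smul_eq_mul]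
        ring }
  have hinner : ∀ v w : 𝓢(𝔼, ℂ), ⟪v.toLp 2, T w⟫_ℂ =
      ∫ x, ⟪v x, ((‖x‖ ^ ε / (1 + ‖x‖ ^ ε) : ℝ) : ℂ) * fderiv ℝ w x (‖x‖⁻¹ • x)⟫_ℂ := by
    intro v w
    rw [L2.inner_def]
    refine integral_congr_ae ?_
    filter_upwards [v.coeFn_toLp 2, (hT w).coeFn_toLp] with x h1 h2
    rw [h1, show (T w : 𝔼 → ℂ) x = _ from h2]
  set Λ := fourierMultiplierCLM (E := 𝔼) ℂ (fun ξ => (g ξ : ℂ)) with hΛ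
  set M := fourierMultiplierCLM (E := 𝔼) ℂ (fun ξ => (((g ξ)⁻¹ : ℝ) : ℂ)) with hM
  have hgC : (fun ξ => (g ξ : ℂ)).HasTemperateGrowth := by fun_prop
  have hgC' : (fun ξ => (((g ξ)⁻¹ : ℝ) : ℂ)).HasTemperateGrowth := by fun_prop
  have hmul : (fun ξ => (g ξ : ℂ)) * (fun ξ => (((g ξ)⁻¹ : ℝ) : ℂ)) = fun _ => 1 := by
    ext ξ
    simp [(hg0 ξ).ne']
  have hgrad : ∀ u : 𝓢(𝔼, ℂ), √(∫ x, ‖fderiv ℝ u x‖ ^ 2) ≤ ‖(Λ u).toLp 2‖ := fun u =>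
    Real.sqrt_le_iff.2 ⟨norm_nonneg _, integral_norm_fderiv_sq_le hg hgξ u⟩
  have key := norm_inner_sq_le_of_endpoints (toLpCLM ℂ ℂ 2 (volume : Measure 𝔼)).toLinearMap T
    Λ.toLinearMap M.toLinearMap (c := δ⁻¹) (α := 1) (β := 7)
    (denseRange_toLpCLM ENNReal.ofNat_ne_top) ?_ ?_ ?_ ?_ ?_ zero_le_one (by norm_num) ?_ ?_ v w
  · simp only [ContinuousLinearMap.coe_coe, toLpCLM_apply, hinner] at key
    rwa [hΛ, re_inner_toLp_fourierMultiplierCLM hg, re_inner_toLp_fourierMultiplierCLM hg,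
      one_mul] at key
  · intro s
    simp only [ContinuousLinearMap.coe_coe, hΛ, hM]
    rw [fourierMultiplierCLM_fourierMultiplierCLM_apply hgC hgC', hmul]
    simp
  · intro s
    simp only [ContinuousLinearMap.coe_coe, hΛ, hM]
    rw [fourierMultiplierCLM_fourierMultiplierCLM_apply hgC' hgC, mul_comm, hmul]
    simp
  · intro s
    simp only [ContinuousLinearMap.coe_coe, toLpCLM_apply]
    refine le_of_sq_le_sq ?_ (by positivity)
    rw [hM, norm_toLp_fourierMultiplierCLM_sq hg', mul_pow, norm_toLp_two_sq,
      ← integral_const_mul]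
    refine integral_mono (integrable_sq_mul_norm_sq hg' _)
      ((integrable_norm_sq _).const_mul _) fun ξ => ?_
    have := hg0 ξ
    have := hδg ξ
    dsimp only
    gcongr
  · intro s t
    simp only [ContinuousLinearMap.coe_coe, toLpCLM_apply, hM]
    rw [inner_toLp_fourierMultiplierCLM hg', inner_fourierMultiplierCLM_toLp hg']
  · intro s
    simp only [ContinuousLinearMap.coe_coe, toLpCLM_apply, hM]
    rw [re_inner_toLp_fourierMultiplierCLM hg']
    exact integral_nonneg fun ξ => mul_nonneg (inv_nonneg.2 (hg0 ξ).le) (by positivity)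
  · intro u
    simp only [ContinuousLinearMap.coe_coe, toLpCLM_apply, one_mul]
    refine le_trans ?_ (hgrad u)
    calc ‖T u‖ = _ := Lp.norm_toLp _ (hT u)
      _ ≤ (eLpNorm (fderiv ℝ u) 2 volume).toReal :=
        ENNReal.toReal_mono u.memLp_fderiv.eLpNorm_ne_top
          (eLpNorm_mono (norm_mul_fderiv_radial_le ha0 ha1 u))
      _ = _ := by
        rw [MemLp.eLpNorm_eq_integral_rpow_norm two_ne_zero ENNReal.ofNat_ne_top u.memLp_fderiv,
          ENNReal.toReal_ofReal (by positivity), ENNReal.toReal_ofNat, ← one_div,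
          ← Real.sqrt_eq_rpow]
        simp_rw [Real.rpow_ofNat]
  · intro v w
    simp only [ContinuousLinearMap.coe_coe, toLpCLM_apply, hinner]
    refine (norm_integral_inner_radial_deriv_le hd hε0 hε1 v w).trans ?_
    have h : √(∫ x, ‖w x‖ ^ 2) = ‖w.toLp 2‖ := by
      rw [← integral_norm_sq_fourier, ← norm_toLp_two_sq, Real.sqrt_sq (norm_nonneg _)]
    rw [h]
    gcongr
    exact hgrad v

theorem sqrt_one_add_norm_sq_bounds {δ : ℝ} (hδ : 0 < δ) (ξ : 𝔼) :
    δ ≤ δ * (1 + ‖(2 * π / δ) • ξ‖ ^ 2) ^ (1 / 2 : ℝ) ∧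
    2 * π * ‖ξ‖ ≤ δ * (1 + ‖(2 * π / δ) • ξ‖ ^ 2) ^ (1 / 2 : ℝ) ∧
    δ * (1 + ‖(2 * π / δ) • ξ‖ ^ 2) ^ (1 / 2 : ℝ) ≤ δ + 2 * π * ‖ξ‖ := by
  have h : 2 * π * ‖ξ‖ = δ * ‖(2 * π / δ) • ξ‖ := by
    rw [norm_smul, Real.norm_of_nonneg (by positivity)]
    field_simp
  rw [h, ← Real.sqrt_eq_rpow]
  set t := ‖(2 * π / δ) • ξ‖ with ht
  have ht0 : 0 ≤ t := norm_nonneg _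
  refine ⟨le_mul_of_one_le_right hδ.le (Real.one_le_sqrt.2 (by nlinarith)), ?_, ?_⟩
  · gcongr
    exact Real.le_sqrt_of_sq_le (by linarith)
  · rw [← mul_one_add]
    gcongr
    exact Real.sqrt_le_iff.2 ⟨by positivity, by nlinarith⟩

theorem SchwartzMap.sq_norm_integral_le (hd : 3 ≤ d) {ε : ℝ} (hε0 : 0 < ε)
    (hε1 : ε < 1) (v w : 𝓢(𝔼, ℂ)) :
    ‖∫ x, ⟪v x, ((‖x‖ ^ ε / (1 + ‖x‖ ^ ε) : ℝ) : ℂ) * fderiv ℝ w x (‖x‖⁻¹ • x)⟫_ℂ‖ ^ 2 ≤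
      7 * (∫ ξ, 2 * π * ‖ξ‖ * ‖𝓕 v ξ‖ ^ 2) * ∫ ξ, 2 * π * ‖ξ‖ * ‖𝓕 w ξ‖ ^ 2 := by
  have hi : ∀ u : 𝓢(𝔼, ℂ), Integrable fun ξ => 2 * π * ‖ξ‖ * ‖𝓕 u ξ‖ ^ 2 := by
    intro u
    have h1 : Integrable fun ξ : 𝔼 => ‖ξ‖ * ‖𝓕 u ξ‖ :=
      ((𝓕 u).integrable_pow_mul volume 1).congr (.of_forall fun ξ => by simp)
    have h2 := h1.mul_bdd (g := fun ξ => ‖𝓕 u ξ‖) (𝓕 u).continuous.norm.aestronglyMeasurable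
      (.of_forall fun ξ => by simpa using norm_le_seminorm ℝ (𝓕 u) ξ)
    refine (h2.const_mul (2 * π)).congr (.of_forall fun ξ => ?_)
    dsimp only
    ring
  have hle : ∀ δ : ℝ, 0 < δ → ‖∫ x, ⟪v x, ((‖x‖ ^ ε / (1 + ‖x‖ ^ ε) : ℝ) : ℂ) *
      fderiv ℝ w x (‖x‖⁻¹ • x)⟫_ℂ‖ ^ 2 ≤
      7 * (δ * (∫ ξ, ‖𝓕 v ξ‖ ^ 2) + ∫ ξ, 2 * π * ‖ξ‖ * ‖𝓕 v ξ‖ ^ 2) *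
        (δ * (∫ ξ, ‖𝓕 w ξ‖ ^ 2) + ∫ ξ, 2 * π * ‖ξ‖ * ‖𝓕 w ξ‖ ^ 2) := by
    intro δ hδ
    have hscale : (fun ξ : 𝔼 => (2 * π / δ) • ξ).HasTemperateGrowth := by fun_prop
    have hb := fun r : ℝ => (Function.hasTemperateGrowth_one_add_norm_sq_rpow 𝔼 r).comp hscale
    have hg : (fun ξ : 𝔼 => δ * (1 + ‖(2 * π / δ) • ξ‖ ^ 2) ^ (1 / 2 : ℝ)).HasTemperateGrowth :=
      (Function.HasTemperateGrowth.const δ).mul (hb _)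
    have hg' : (fun ξ : 𝔼 =>
        (δ * (1 + ‖(2 * π / δ) • ξ‖ ^ 2) ^ (1 / 2 : ℝ))⁻¹).HasTemperateGrowth := by
      have : (fun ξ : 𝔼 => (δ * (1 + ‖(2 * π / δ) • ξ‖ ^ 2) ^ (1 / 2 : ℝ))⁻¹) =
          fun ξ => δ⁻¹ * (1 + ‖(2 * π / δ) • ξ‖ ^ 2) ^ (-(1 / 2) : ℝ) := by
        ext ξ
        rw [mul_inv, Real.rpow_neg (by positivity)]
      rw [this]
      exact (Function.HasTemperateGrowth.const δ⁻¹).mul (hb _)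
    have hbound : ∀ u : 𝓢(𝔼, ℂ),
        ∫ ξ, δ * (1 + ‖(2 * π / δ) • ξ‖ ^ 2) ^ (1 / 2 : ℝ) * ‖𝓕 u ξ‖ ^ 2 ≤
          δ * (∫ ξ, ‖𝓕 u ξ‖ ^ 2) + ∫ ξ, 2 * π * ‖ξ‖ * ‖𝓕 u ξ‖ ^ 2 := by
      intro u
      have hn := (integrable_norm_sq (𝓕 u)).const_mul δ
      rw [← integral_const_mul, ← integral_add hn (hi u)]
      refine integral_mono_of_nonneg (.of_forall fun ξ => by positivity) (hn.add (hi u))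
        (.of_forall fun ξ => ?_)
      dsimp only
      rw [← add_mul]
      gcongr
      exact (sqrt_one_add_norm_sq_bounds hδ ξ).2.2
    refine (sq_norm_integral_le_of_multiplier hd hε0 hε1 hg hg' hδ
      (fun ξ => (sqrt_one_add_norm_sq_bounds hδ ξ).1)
      (fun ξ => (sqrt_one_add_norm_sq_bounds hδ ξ).2.1) v w).trans ?_
    gcongr
    · exact hbound v
    · exact hbound w
  have hlim : Tendsto (fun δ : ℝ =>
      7 * (δ * (∫ ξ, ‖𝓕 v ξ‖ ^ 2) + ∫ ξ, 2 * π * ‖ξ‖ * ‖𝓕 v ξ‖ ^ 2) *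
        (δ * (∫ ξ, ‖𝓕 w ξ‖ ^ 2) + ∫ ξ, 2 * π * ‖ξ‖ * ‖𝓕 w ξ‖ ^ 2)) (𝓝[>] 0)
      (𝓝 (7 * (∫ ξ, 2 * π * ‖ξ‖ * ‖𝓕 v ξ‖ ^ 2) * ∫ ξ, 2 * π * ‖ξ‖ * ‖𝓕 w ξ‖ ^ 2)) := by
    refine (Continuous.tendsto' (by fun_prop) _ _ (by simp)).mono_left nhdsWithin_le_nhds
  exact ge_of_tendsto hlim (eventually_mem_nhdsWithin.mono fun δ hδ => hle δ hδ)

end Radial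

theorem stmt10 (d : ℕ) (hd : 3 ≤ d) (ε : ℝ) (hε0 : 0 < ε) (hε1 : ε < 1)
    (v w : SchwartzMap (EuclideanSpace ℝ (Fin d)) ℂ) :
    ‖∫ x, starRingEnd ℂ (v x) *
        (((‖x‖ ^ ε / (1 + ‖x‖ ^ ε) : ℝ) : ℂ) * fderiv ℝ (⇑w) x (‖x‖⁻¹ • x))‖ ≤
      3 * (∫ ξ, 2 * π * ‖ξ‖ * ‖𝓕 (⇑v) ξ‖ ^ 2) ^ (1 / 2 : ℝ) *
        (∫ ξ, 2 * π * ‖ξ‖ * ‖𝓕 (⇑w) ξ‖ ^ 2) ^ (1 / 2 : ℝ) := by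
  have h := SchwartzMap.sq_norm_integral_le hd hε0 hε1 v w
  simp only [RCLike.inner_apply, mul_comm _ (starRingEnd ℂ (v _)), SchwartzMap.fourier_coe] at h
  have hv : 0 ≤ ∫ ξ, 2 * π * ‖ξ‖ * ‖𝓕 (⇑v) ξ‖ ^ 2 := integral_nonneg fun ξ => by positivity
  have hw : 0 ≤ ∫ ξ, 2 * π * ‖ξ‖ * ‖𝓕 (⇑w) ξ‖ ^ 2 := integral_nonneg fun ξ => by positivity
  rw [← Real.sqrt_eq_rpow, ← Real.sqrt_eq_rpow]
  refine le_of_sq_le_sq (h.trans ?_) (by positivity)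
  rw [mul_pow, mul_pow, Real.sq_sqrt hv, Real.sq_sqrt hw]
  gcongr
  norm_num
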